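/- Let H be a directed graph with unit arc weights, p* a directed s–t path, and E' a directed Force Path Cut solution for (H,p*) of minimum size. Then for every pair of vertices u,v, if (u,v)∈E' then (v,u)∉E'. -/

import Mathlib

/-- `p` (a list of vertices) is a directed path from `s` to `t` in the directed graph
with arc set `A`: it starts at `s`, ends at `t`, consecutive vertices are joined by
arcs of `A`, and no vertex repeats.  Its length (number of arcs) is `p.length - 1`. -/
def IsDiPath {V : Type*} (A : Set (V × V)) (s t : V) (p : List V) : Prop :=
  p.head? = some s ∧ p.getLast? = some t ∧
    p.Chain' (fun u v => (u, v) ∈ A) ∧ p.Nodup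

/-- `E'` is a directed Force Path Cut solution for the directed graph with arc set `A`
(unit arc weights), terminals `s, t` and target directed path `p` (given by its vertex
list): `E'` consists of arcs of `A`, avoids the arcs of `p`, and after removing `E'`
the path `p` is strictly shorter than every other directed `s`–`t` path. -/
def DiFPCSol {V : Type*} (A : Set (V × V)) (s t : V) (p : List V)
    (E' : Set (V × V)) : Prop :=
  E' ⊆ A ∧ (∀ a ∈ p.zip p.tail, a ∉ E') ∧
    ∀ q : List V, IsDiPath (A \ E') s t q → q ≠ p → p.length < q.length

/-- `E'` is a Force Path Cut solution for the undirected graph `G` with unit edge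
weights and target path `p`. -/
def FPCSol {V : Type*} (G : SimpleGraph V) {s t : V} (p : G.Walk s t)
    (E' : Set (Sym2 V)) : Prop :=
  E' ⊆ G.edgeSet ∧ (∀ e ∈ p.edges, e ∉ E') ∧
    ∀ q : (G.deleteEdges E').Walk s t, q.IsPath →
      q.mapLe (SimpleGraph.deleteEdges_le E') ≠ p → p.length < q.length

/-- The arc set of the bidirected version of the undirected graph `G`. -/
def biArcs {V : Type*} (G : SimpleGraph V) : Set (V × V) :=
  {a : V × V | G.Adj a.1 a.2}

/-- A walk, given by its vertex list, contains a path with the same ends that is not longer. -/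
theorem exists_isDiPath_of_isChain {V : Type*} {A : Set (V × V)} {t : V} {l : List V} {s : V}
    (hs : l.head? = some s) (ht : l.getLast? = some t)
    (hl : l.IsChain (fun u v => (u, v) ∈ A)) :
    ∃ p, IsDiPath A s t p ∧ p.length ≤ l.length := by
  induction l generalizing s with
  | nil => simp at hs
  | cons x l ih =>
    obtain rfl : x = s := by simpa using hs
    cases l with
    | nil => exact ⟨[x], ⟨hs, ht, List.isChain_singleton x, by simp⟩, le_rfl⟩
    | cons y l =>
      obtain ⟨hxy, hyl⟩ := List.isChain_cons_cons.mp hl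
      obtain ⟨p, ⟨hp₁, hp₂, hp₃, hp₄⟩, hpl⟩ := ih rfl (by simpa using ht) hyl
      by_cases hx : x ∈ p
      · obtain ⟨p₁, p₂, rfl⟩ := List.append_of_mem hx
        refine ⟨x :: p₂, ⟨rfl, by simpa using hp₂, List.IsChain.right_of_append hp₃,
          hp₄.of_append_right⟩, ?_⟩
        simp only [List.length_append, List.length_cons] at hpl ⊢
        omega
      · refine ⟨x :: p, ⟨rfl, ?_, ?_, List.nodup_cons.mpr ⟨hx, hp₄⟩⟩, by simpa using hpl⟩
        · simp [List.getLast?_cons, hp₂]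
        · refine List.isChain_cons.mpr ⟨fun z hz => ?_, hp₃⟩
          obtain rfl : y = z := by simpa [hp₁] using hz
          exact hxy

/-- If a solution no longer is one after an arc `(u, v)` is taken out of it, then some path
through `(u, v)` that is not longer than `p` uses no other removed arc. -/
theorem DiFPCSol.exists_split {V : Type*} {A : Set (V × V)} {s t : V} {p : List V}
    {E : Set (V × V)} (hE : DiFPCSol A s t p E) {u v : V}
    (h : ¬ DiFPCSol A s t p (E \ {(u, v)})) :
    ∃ l₁ l₂ : List V, (l₁ ++ [u]).head? = some s ∧ (v :: l₂).getLast? = some t ∧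
      (l₁ ++ [u]).IsChain (fun a b => (a, b) ∈ A \ E) ∧
      (v :: l₂).IsChain (fun a b => (a, b) ∈ A \ E) ∧
      l₁.length + l₂.length + 2 ≤ p.length := by
  obtain ⟨hEA, hEp, hE⟩ := hE
  have hq : ∃ q, IsDiPath (A \ (E \ {(u, v)})) s t q ∧ q ≠ p ∧ q.length ≤ p.length := by
    by_contra! hq
    exact h ⟨Set.sdiff_subset.trans hEA, fun a ha haE => hEp a ha haE.1, hq⟩
  obtain ⟨q, ⟨hq₁, hq₂, hq₃, hq₄⟩, hqp, hql⟩ := hq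
  replace hq₃ : q.IsChain (fun a b => (a, b) ∈ A \ (E \ {(u, v)})) := hq₃
  have hsplit : ¬ q.IsChain (fun a b => (a, b) ∈ A \ E) := fun hc =>
    (hE q ⟨hq₁, hq₂, hc, hq₄⟩ hqp).not_ge hql
  rw [List.isChain_iff_forall_rel_of_append_cons_cons] at hsplit
  push Not at hsplit
  obtain ⟨a, b, l₁, l₂, rfl, hab⟩ := hsplit
  obtain ⟨hc₁, hc, hc₂⟩ := List.isChain_append_cons_cons.mp hq₃
  obtain ⟨rfl, rfl⟩ : a = u ∧ b = v := by
    by_contra hne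
    exact hab ⟨hc.1, fun hmem => hc.2 ⟨hmem, by simpa using hne⟩⟩
  refine ⟨l₁, l₂, ?_, by simpa using hq₂, hc₁.imp_of_mem_imp ?_, hc₂.imp_of_mem_imp ?_, ?_⟩
  · cases l₁ <;> simpa using hq₁
  · rintro x y - hy ⟨hxA, hxE⟩
    refine ⟨hxA, fun hmem => hxE ⟨hmem, ?_⟩⟩
    rintro ⟨⟩
    grind
  · rintro x y hx - ⟨hxA, hxE⟩
    refine ⟨hxA, fun hmem => hxE ⟨hmem, ?_⟩⟩
    rintro ⟨⟩
    grind
  · simp only [List.length_append, List.length_cons] at hql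
    omega

/-- If `E'` is a minimum-size directed Force Path Cut solution for
`(H, p*)`, then `E'` never contains both an arc and its reverse. -/
theorem stmt9 {V : Type*} [Fintype V] (A : Set (V × V)) (s t : V) (hst : s ≠ t)
    (pstar : List V) (hpstar : IsDiPath A s t pstar)
    (E' : Set (V × V)) (hsol : DiFPCSol A s t pstar E')
    (hmin : ∀ E'' : Set (V × V), DiFPCSol A s t pstar E'' → E'.ncard ≤ E''.ncard) :
    ∀ u v : V, (u, v) ∈ E' → (v, u) ∉ E' := by
  have hnot : ∀ a ∈ E', ¬ DiFPCSol A s t pstar (E' \ {a}) := fun a ha h =>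
    (Set.ncard_sdiff_singleton_lt_of_mem ha (Set.toFinite E')).not_ge (hmin _ h)
  have hwalk : ∀ l : List V, l.head? = some s → l.getLast? = some t →
      l.IsChain (fun a b => (a, b) ∈ A \ E') → pstar.length ≤ l.length := by
    intro l hs ht hl
    obtain ⟨p, hp, hpl⟩ := exists_isDiPath_of_isChain hs ht hl
    rcases eq_or_ne p pstar with rfl | hne
    · exact hpl
    · exact (hsol.2.2 p hp hne).le.trans hpl
  intro u v huv hvu
  obtain ⟨l₁, l₂, hls, hlt, hl₁, hl₂, hl⟩ := hsol.exists_split (hnot _ huv)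
  obtain ⟨m₁, m₂, hms, hmt, hm₁, hm₂, hm⟩ := hsol.exists_split (hnot _ hvu)
  have hu := hwalk (l₁ ++ u :: m₂) (by cases l₁ <;> simpa using hls) (by simpa using hmt)
    (List.isChain_split.mpr ⟨hl₁, hm₂⟩)
  have hv := hwalk (m₁ ++ v :: l₂) (by cases m₁ <;> simpa using hms) (by simpa using hlt)
    (List.isChain_split.mpr ⟨hm₁, hl₂⟩)
  simp only [List.length_append, List.length_cons] at hu hv
  omega
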